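/- Assume MA_ctble. Then there exists a nonprincipal ultrafilter 𝒰 on ℕ that is a 𝒲-ultrafilter but is not a Q-point. -/

import Mathlib

open Set Filter Cardinal

/-- A set `A ⊆ ℕ` is an AP-set if it contains arithmetic progressions of every finite length. -/
def IsAPSet (A : Set ℕ) : Prop :=
  ∀ k : ℕ, ∃ a d : ℕ, 1 ≤ d ∧ ∀ i < k, a + i * d ∈ A

/-- `A` contains a 3-term arithmetic progression `{a, a+d, a+2d}` with `d ≥ 1`. -/
def Has3AP (A : Set ℕ) : Prop :=
  ∃ a d : ℕ, 1 ≤ d ∧ a ∈ A ∧ a + d ∈ A ∧ a + 2 * d ∈ A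

/-- `f` is finite-to-one: each fiber is finite. -/
def FiniteToOne (f : ℕ → ℕ) : Prop := ∀ m : ℕ, (f ⁻¹' {m}).Finite

/-- A nonprincipal ultrafilter `𝒰` on ℕ is a Q-point if for every partition of ℕ into finite
sets there is a member of `𝒰` meeting each piece in at most one point. -/
def IsQPoint (𝒰 : Ultrafilter ℕ) : Prop :=
  (∀ a : ℕ, 𝒰 ≠ pure a) ∧
    ∀ Q : ℕ → Set ℕ, (∀ n, (Q n).Finite) →
      (∀ m n, m ≠ n → Disjoint (Q m) (Q n)) → (⋃ n, Q n) = Set.univ →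
      ∃ A ∈ 𝒰, ∀ n, (A ∩ Q n).Subsingleton

/-- A filter base on ℕ. -/
def IsFilterBase (𝓕 : Set (Set ℕ)) : Prop :=
  𝓕.Nonempty ∧ ∀ A ∈ 𝓕, ∀ B ∈ 𝓕, ∃ C ∈ 𝓕, C ⊆ A ∩ B

/-- Property (♠): every member of the family has at least `k` elements in some dyadic
interval `[2ⁿ, 2ⁿ⁺¹)`, for every `k`. -/
def Spade (𝓕 : Set (Set ℕ)) : Prop :=
  ∀ F ∈ 𝓕, ∀ k : ℕ, ∃ n : ℕ, k ≤ (F ∩ Set.Ico (2 ^ n) (2 ^ (n + 1))).ncard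

/-- A dense subset of a poset. -/
def PosetDense {P : Type} [PartialOrder P] (D : Set P) : Prop :=
  ∀ p : P, ∃ q ∈ D, q ≤ p

/-- A filter on a poset: nonempty, upward closed, downward directed. -/
def PosetFilter {P : Type} [PartialOrder P] (G : Set P) : Prop :=
  G.Nonempty ∧ (∀ p ∈ G, ∀ q, p ≤ q → q ∈ G) ∧
    ∀ p ∈ G, ∀ q ∈ G, ∃ r ∈ G, r ≤ p ∧ r ≤ q

/-- Martin's axiom for countable posets. -/
def MActble : Prop :=
  ∀ (P : Type) [PartialOrder P] [Countable P] [Nonempty P],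
    ∀ 𝒟 : Set (Set P), (∀ D ∈ 𝒟, PosetDense D) → #𝒟 < Cardinal.continuum →
      ∃ G : Set P, PosetFilter G ∧ ∀ D ∈ 𝒟, (G ∩ D).Nonempty

/-- A rapid ultrafilter: the enumeration functions of its members form a dominating family. -/
def IsRapid (𝒰 : Ultrafilter ℕ) : Prop :=
  ∀ h : ℕ → ℕ, ∃ B ∈ 𝒰, B.Infinite ∧ ∀ᶠ n in Filter.atTop, h n ≤ Nat.nth (· ∈ B) n

/-- A hereditarily rapid ultrafilter: all its images under maps `ℕ → ℕ` are rapid. -/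
def IsHereditarilyRapid (𝒰 : Ultrafilter ℕ) : Prop :=
  IsRapid 𝒰 ∧ ∀ f : ℕ → ℕ, IsRapid (Ultrafilter.map f 𝒰)

/-- The points that can complete a 3-term arithmetic progression having its two other points
in `T`. -/
def completions (T : Finset ℕ) : Finset ℕ :=
  Finset.image₂ (fun a b => 2 * b - a) T T ∪ Finset.image₂ (fun a b => (a + b) / 2) T T

lemma card_completions_le (T : Finset ℕ) : (completions T).card ≤ 2 * (T.card * T.card) := by
  refine (Finset.card_union_le _ _).trans ?_
  have h₁ := Finset.card_image₂_le (fun a b : ℕ => 2 * b - a) T T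
  have h₂ := Finset.card_image₂_le (fun a b : ℕ => (a + b) / 2) T T
  omega

lemma not_has3AP_insert {T : Finset ℕ} {v : ℕ} (hT : ¬ Has3AP (T : Set ℕ))
    (hv : v ∉ completions T) : ¬ Has3AP (insert v (T : Set ℕ)) := by
  rintro ⟨a, d, hd, h₀, h₁, h₂⟩
  simp only [completions, Finset.mem_union, Finset.mem_image₂, not_or, not_exists, not_and] at hv
  obtain ⟨hv₁, hv₂⟩ := hv
  simp only [Set.mem_insert_iff, Finset.mem_coe] at h₀ h₁ h₂
  rcases h₀ with h₀ | h₀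
  · exact hv₁ (a + 2 * d) (h₂.resolve_left (by omega)) (a + d) (h₁.resolve_left (by omega))
      (by omega)
  rcases h₁ with h₁ | h₁
  · exact hv₂ a h₀ (a + 2 * d) (h₂.resolve_left (by omega)) (by omega)
  rcases h₂ with h₂ | h₂
  · exact hv₁ a h₀ (a + d) h₁ (by omega)
  · exact hT ⟨a, d, hd, h₀, h₁, h₂⟩

lemma Has3AP.mono {A B : Set ℕ} (h : A ⊆ B) : Has3AP A → Has3AP B := by
  rintro ⟨a, d, hd, h₀, h₁, h₂⟩
  exact ⟨a, d, hd, h h₀, h h₁, h h₂⟩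

lemma IsAPSet.has3AP {A : Set ℕ} (h : IsAPSet A) : Has3AP A := by
  obtain ⟨a, d, hd, H⟩ := h 3
  exact ⟨a, d, hd, by simpa using H 0 (by norm_num), by simpa using H 1 (by norm_num),
    H 2 (by norm_num)⟩

/-- A finite set whose image is free of 3-term progressions can be extended, preserving this, by
`k` points of any large enough set whose image avoids the completions. -/
lemma exists_extension (f : ℕ → ℕ) (S X : Finset ℕ) (k : ℕ)
    (hS : ¬ Has3AP (S.image f : Set ℕ))
    (hX : ∀ x ∈ X, f x ∉ completions (S.image f))
    (hcard : k + k * (2 * ((S.card + k) * (S.card + k))) < X.card) :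
    ∃ Y ⊆ X, k ≤ Y.card ∧ ¬ Has3AP ((S ∪ Y).image f : Set ℕ) := by
  classical
  by_contra! hcon
  have hfib : ∀ v, (X.filter (fun x => f x = v)).card ≤ k := by
    intro v
    by_contra! hv
    obtain ⟨x, hx⟩ : (X.filter (fun x => f x = v)).Nonempty := Finset.card_pos.1 (by omega)
    rw [Finset.mem_filter] at hx
    refine (not_has3AP_insert hS (v := v) (hx.2 ▸ hX x hx.1)) (Has3AP.mono ?_
      (hcon _ (Finset.filter_subset _ _) hv.le))
    intro y hy
    simp only [Finset.coe_image, Set.mem_image, Finset.mem_coe, Finset.mem_union,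
      Finset.mem_filter] at hy
    obtain ⟨z, hz | hz, rfl⟩ := hy
    · exact Or.inr (by simpa using ⟨z, hz, rfl⟩)
    · exact Or.inl hz.2
  obtain ⟨Y, hY, hmax⟩ := Finset.exists_max_image
    (X.powerset.filter (fun Y => ¬ Has3AP ((S ∪ Y).image f : Set ℕ))) Finset.card
    ⟨∅, by simpa using hS⟩
  simp only [Finset.mem_filter, Finset.mem_powerset] at hY hmax
  have hYk : Y.card < k := by
    by_contra! h
    exact hY.2 (hcon Y hY.1 h)
  set E := completions ((S ∪ Y).image f)
  have hE : E.card ≤ 2 * ((S.card + k) * (S.card + k)) := by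
    refine (card_completions_le _).trans ?_
    have : ((S ∪ Y).image f).card ≤ S.card + k :=
      Finset.card_image_le.trans ((Finset.card_union_le _ _).trans (by omega))
    gcongr
  have hsub : X ⊆ Y ∪ X.filter (fun x => f x ∈ E) := by
    intro x hx
    by_contra hxn
    simp only [Finset.mem_union, Finset.mem_filter, not_or, not_and] at hxn
    have := hmax (insert x Y) ⟨Finset.insert_subset hx hY.1, by
      rw [Finset.union_insert, Finset.image_insert, Finset.coe_insert]
      exact not_has3AP_insert hY.2 (hxn.2 hx)⟩
    rw [Finset.card_insert_of_notMem hxn.1] at this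
    omega
  have h₁ : (X.filter (fun x => f x ∈ E)).card ≤ k * E.card :=
    Finset.card_le_mul_card_image_of_maps_to (f := f) (by simp) k fun b _ =>
      (Finset.card_le_card (Finset.filter_subset_filter _ (Finset.filter_subset _ _))).trans (hfib b)
  have h₂ := (Finset.card_le_card hsub).trans (Finset.card_union_le _ _)
  have h₃ : k * E.card ≤ k * (2 * ((S.card + k) * (S.card + k))) := by gcongr
  omega

/-- The part of `A` in the dyadic interval `[2ⁿ, 2ⁿ⁺¹)`. -/
noncomputable def dyadicPart (A : Set ℕ) (n : ℕ) : Finset ℕ :=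
  open Classical in (Finset.Ico (2 ^ n) (2 ^ (n + 1))).filter (· ∈ A)

lemma mem_dyadicPart {A : Set ℕ} {n x : ℕ} :
    x ∈ dyadicPart A n ↔ (2 ^ n ≤ x ∧ x < 2 ^ (n + 1)) ∧ x ∈ A := by
  simp [dyadicPart]

lemma dyadicPart_mono {A B : Set ℕ} (h : A ⊆ B) (n : ℕ) : dyadicPart A n ⊆ dyadicPart B n := by
  intro x
  simp only [mem_dyadicPart]
  exact fun hx => ⟨hx.1, h hx.2⟩

/-- The filter of sets whose complement has boundedly many elements in the dyadic intervals. -/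
def dyadicFilter : Filter ℕ where
  sets := {A | ∃ k, ∀ n, (dyadicPart Aᶜ n).card ≤ k}
  univ_sets := ⟨0, fun n => by simp [dyadicPart]⟩
  sets_of_superset := by
    rintro A B ⟨k, hk⟩ hAB
    exact ⟨k, fun n => (Finset.card_le_card
      (dyadicPart_mono (Set.compl_subset_compl.2 hAB) n)).trans (hk n)⟩
  inter_sets := by
    rintro A B ⟨k, hk⟩ ⟨l, hl⟩
    refine ⟨k + l, fun n => ?_⟩
    have : dyadicPart (A ∩ B)ᶜ n ⊆ dyadicPart Aᶜ n ∪ dyadicPart Bᶜ n := by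
      intro x
      simp only [Finset.mem_union, mem_dyadicPart, Set.mem_compl_iff, Set.mem_inter_iff]
      tauto
    exact (Finset.card_le_card this).trans
      ((Finset.card_union_le _ _).trans (add_le_add (hk n) (hl n)))

lemma mem_dyadicFilter {A : Set ℕ} :
    A ∈ dyadicFilter ↔ ∃ k, ∀ n, (dyadicPart Aᶜ n).card ≤ k := Iff.rfl

lemma dyadicFilter_inf_principal_neBot {A : Set ℕ} :
    (dyadicFilter ⊓ 𝓟 A).NeBot ↔ ∀ k, ∃ n, k < (dyadicPart A n).card := by
  rw [neBot_iff, Ne, inf_principal_eq_bot, mem_dyadicFilter, compl_compl]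
  push Not
  rfl

instance : NeBot dyadicFilter := by
  have : (dyadicFilter ⊓ 𝓟 Set.univ).NeBot := by
    refine dyadicFilter_inf_principal_neBot.2 fun k => ⟨k, ?_⟩
    have : 2 ^ (k + 1) - 2 ^ k = 2 ^ k := by rw [pow_succ]; omega
    simpa [dyadicPart, this] using Nat.lt_two_pow_self
  simpa using this

/-- The forcing step: fewer than continuum many sets which are positive together with
`dyadicFilter` admit one more set with image outside the van der Waerden ideal. -/
lemma exists_not_isAPSet_image (hMA : MActble) {ι : Type} (hι : #ι < continuum)
    (A : ι → Set ℕ) (hA : (dyadicFilter ⊓ ⨅ i, 𝓟 (A i)).NeBot) (f : ℕ → ℕ) :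
    ∃ B : Set ℕ, ¬ IsAPSet (f '' B) ∧ ((dyadicFilter ⊓ ⨅ i, 𝓟 (A i)) ⊓ 𝓟 B).NeBot := by
  classical
  by_cases hconst : ∃ m, ((dyadicFilter ⊓ ⨅ i, 𝓟 (A i)) ⊓ 𝓟 (f ⁻¹' {m})).NeBot
  · obtain ⟨m, hm⟩ := hconst
    refine ⟨_, fun h => ?_, hm⟩
    obtain ⟨a, d, hd, h₀, h₁, -⟩ := h.has3AP
    have h₀ := Set.image_preimage_subset _ _ h₀
    have h₁ := Set.image_preimage_subset _ _ h₁
    simp only [Set.mem_singleton_iff] at h₀ h₁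
    omega
  have hfin : ∀ K : Finset ℕ, (f ⁻¹' (K : Set ℕ))ᶜ ∈ dyadicFilter ⊓ ⨅ i, 𝓟 (A i) := by
    intro K
    have : (f ⁻¹' (K : Set ℕ))ᶜ = ⋂ m ∈ K, (f ⁻¹' {m})ᶜ := by
      ext x
      simp only [Set.mem_compl_iff, Set.mem_preimage, Finset.mem_coe, Set.mem_iInter,
        Set.mem_singleton_iff]
      exact ⟨fun h m hm e => h (e ▸ hm), fun h hx => h _ hx rfl⟩
    rw [this, Filter.biInter_finset_mem]
    intro m _
    by_contra h
    exact hconst ⟨m, by rwa [neBot_iff, Ne, inf_principal_eq_bot]⟩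
  let P : Type := {p : (Finset ℕ)ᵒᵈ // ¬ Has3AP ((OrderDual.ofDual p).image f : Set ℕ)}
  let toFin : P → Finset ℕ := fun p => OrderDual.ofDual p.1
  let F : Finset ι → Set ℕ := fun t => ⋂ i ∈ t, A i
  have hF : ∀ t, F t ∈ dyadicFilter ⊓ ⨅ i, 𝓟 (A i) := fun t =>
    (Filter.biInter_finset_mem t).2 fun i _ =>
      mem_inf_of_right (mem_iInf_of_mem i (mem_principal_self _))
  let D : Finset ι × ℕ → Set P := fun q =>
    {p | ∃ n, q.2 ≤ (dyadicPart (F q.1 ∩ (toFin p : Set ℕ)) n).card}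
  have : Nonempty P := ⟨⟨OrderDual.toDual ∅, by rintro ⟨a, d, -, h, -⟩; simp at h⟩⟩
  have : Countable P := Function.Injective.countable (f := toFin) fun _ _ h => Subtype.ext h
  have hD : ∀ q, PosetDense (D q) := by
    rintro ⟨t, k⟩ p
    set S := toFin p
    have hpos : (dyadicFilter ⊓ 𝓟 (F t ∩ (f ⁻¹' (completions (S.image f) : Set ℕ))ᶜ)).NeBot :=
      hA.mono (le_inf inf_le_left (le_principal_iff.2 (inter_mem (hF t) (hfin _))))
    obtain ⟨n, hn⟩ := dyadicFilter_inf_principal_neBot.1 hpos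
      (k + k * (2 * ((S.card + k) * (S.card + k))))
    obtain ⟨Y, hYX, hYk, hY⟩ := exists_extension f S _ k p.2
      (fun x hx => by simpa using (mem_dyadicPart.1 hx).2.2) hn
    refine ⟨⟨OrderDual.toDual (S ∪ Y), hY⟩, ⟨n, hYk.trans (Finset.card_le_card ?_)⟩,
      (Finset.subset_union_left : S ⊆ S ∪ Y)⟩
    intro x hx
    have := mem_dyadicPart.1 (hYX hx)
    exact mem_dyadicPart.2 ⟨this.1, this.2.1, Finset.mem_coe.2 (Finset.mem_union_right _ hx)⟩
  have hcard : #(Set.range D) < continuum := by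
    refine mk_range_le.trans_lt ?_
    rw [mk_prod, lift_id, lift_id, mk_nat]
    refine mul_lt_of_lt aleph0_le_continuum ?_ aleph0_lt_continuum
    cases finite_or_infinite ι
    · exact (lt_aleph0_of_finite _).trans aleph0_lt_continuum
    · rwa [mk_finset_of_infinite]
  obtain ⟨G, ⟨-, -, hdir⟩, hG⟩ := hMA P (Set.range D) (by rintro _ ⟨q, rfl⟩; exact hD q) hcard
  refine ⟨⋃ p ∈ G, (toFin p : Set ℕ), fun h => ?_, ?_⟩
  · obtain ⟨a, d, hd, ⟨x, hx, hxa⟩, ⟨y, hy, hya⟩, ⟨z, hz, hza⟩⟩ := h.has3AP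
    simp only [Set.mem_iUnion, exists_prop] at hx hy hz
    obtain ⟨p, hp, hx⟩ := hx
    obtain ⟨q, hq, hy⟩ := hy
    obtain ⟨r, hr, hz⟩ := hz
    obtain ⟨s, hs, hsp, hsq⟩ := hdir p hp q hq
    obtain ⟨u, hu, hus, hur⟩ := hdir s hs r hr
    have hup : toFin p ⊆ toFin u := hus.trans hsp
    have huq : toFin q ⊆ toFin u := hus.trans hsq
    have hur : toFin r ⊆ toFin u := hur
    refine u.2 ⟨a, d, hd, ?_, ?_, ?_⟩
    · exact Finset.mem_coe.2 (Finset.mem_image.2 ⟨x, hup hx, hxa⟩)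
    · exact Finset.mem_coe.2 (Finset.mem_image.2 ⟨y, huq hy, hya⟩)
    · exact Finset.mem_coe.2 (Finset.mem_image.2 ⟨z, hur hz, hza⟩)
  · rw [inf_assoc, inf_neBot_iff]
    intro U hU V hV
    obtain ⟨t, htfin, ht⟩ := ((hasBasis_iInf_principal_finite A).inf_principal _).mem_iff.1 hV
    suffices (dyadicFilter ⊓ 𝓟 V).NeBot from inf_principal_neBot_iff.1 this U hU
    refine dyadicFilter_inf_principal_neBot.2 fun k => ?_
    obtain ⟨p, hp, n, hn⟩ := hG _ ⟨(htfin.toFinset, k + 1), rfl⟩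
    refine ⟨n, Nat.lt_of_succ_le (hn.trans (Finset.card_le_card (dyadicPart_mono ?_ n)))⟩
    refine subset_trans (Set.inter_subset_inter ?_
      (Set.subset_biUnion_of_mem (u := fun p => (toFin p : Set ℕ)) hp)) ht
    simp [F]

lemma neBot_inf_biInf_principal {I X : Type*} [LinearOrder I] (H : Filter X) [NeBot H]
    (A : I → Set X) (s : Set I) (h : ∀ i ∈ s, (H ⊓ ⨅ j ∈ Set.Iic i, 𝓟 (A j)).NeBot) :
    (H ⊓ ⨅ i ∈ s, 𝓟 (A i)).NeBot := by
  rcases s.eq_empty_or_nonempty with rfl | hs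
  · simpa
  have := hs.to_subtype
  have hne : (⨅ i : s, H ⊓ ⨅ j ∈ Set.Iic i.1, 𝓟 (A j)).NeBot := by
    refine iInf_neBot_of_directed' ?_ fun i => h i i.2
    have hanti : Antitone fun i : s => H ⊓ ⨅ j ∈ Set.Iic i.1, 𝓟 (A j) := fun i i' hii' =>
      inf_le_inf_left _ (biInf_mono fun j hj => le_trans hj hii')
    exact hanti.directed_ge
  refine hne.mono (le_inf ((iInf_le _ ⟨hs.some, hs.some_mem⟩).trans inf_le_left) ?_)
  exact le_iInf₂ fun i hi => (iInf_le _ ⟨i, hi⟩).trans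
    (inf_le_right.trans (iInf₂_le i (Set.mem_Iic.2 le_rfl)))

/-- Transfinite recursion building a family of sets which keeps a filter proper. -/
lemma exists_family_neBot {I X : Type*} [LinearOrder I] [WellFoundedLT I] (H : Filter X) [NeBot H]
    (Q : I → Set X → Prop)
    (step : ∀ i (A : ∀ j, j < i → Set X), (H ⊓ ⨅ j, ⨅ h : j < i, 𝓟 (A j h)).NeBot →
      ∃ B, Q i B ∧ ((H ⊓ ⨅ j, ⨅ h : j < i, 𝓟 (A j h)) ⊓ 𝓟 B).NeBot) :
    ∃ A : I → Set X, (∀ i, Q i (A i)) ∧ (H ⊓ ⨅ i, 𝓟 (A i)).NeBot := by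
  classical
  let A : I → Set X := WellFoundedLT.fix fun i A =>
    if h : (H ⊓ ⨅ j, ⨅ h : j < i, 𝓟 (A j h)).NeBot then (step i A h).choose else Set.univ
  have hA : ∀ i, (H ⊓ ⨅ j, ⨅ _ : j < i, 𝓟 (A j)).NeBot →
      Q i (A i) ∧ ((H ⊓ ⨅ j, ⨅ _ : j < i, 𝓟 (A j)) ⊓ 𝓟 (A i)).NeBot := by
    intro i hi
    have : A i = (step i (fun j _ => A j) hi).choose := by
      simp only [A]
      rw [WellFoundedLT.fix_eq]
      exact dif_pos hi
    rw [this]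
    exact (step i (fun j _ => A j) hi).choose_spec
  have hIio : ∀ i, (H ⊓ ⨅ j, ⨅ _ : j < i, 𝓟 (A j)).NeBot →
      (H ⊓ ⨅ j ∈ Set.Iic i, 𝓟 (A j)).NeBot := by
    intro i hi
    refine (hA i hi).2.mono (le_inf (inf_le_left.trans inf_le_left) (le_iInf₂ fun j hj => ?_))
    rcases (Set.mem_Iic.1 hj).lt_or_eq with h | rfl
    · exact inf_le_left.trans (inf_le_right.trans (iInf₂_le j h))
    · exact inf_le_right
  have hall : ∀ i, (H ⊓ ⨅ j, ⨅ _ : j < i, 𝓟 (A j)).NeBot := fun i =>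
    WellFoundedLT.induction i fun i ih =>
      neBot_inf_biInf_principal H A (Set.Iio i) fun j hj => hIio j (ih j hj)
  refine ⟨A, fun i => (hA i (hall i)).1, ?_⟩
  simpa using neBot_inf_biInf_principal H A Set.univ fun i _ => hIio i (hall i)

lemma ne_pure_of_le_dyadicFilter {𝒰 : Ultrafilter ℕ} (h : (𝒰 : Filter ℕ) ≤ dyadicFilter)
    (a : ℕ) : 𝒰 ≠ pure a := by
  rintro rfl
  have : ({a}ᶜ : Set ℕ) ∈ dyadicFilter := by
    refine mem_dyadicFilter.2 ⟨1, fun n => Finset.card_le_one.2 fun x hx y hy => ?_⟩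
    have hx := (mem_dyadicPart.1 hx).2
    have hy := (mem_dyadicPart.1 hy).2
    simp only [compl_compl, Set.mem_singleton_iff] at hx hy
    rw [hx, hy]
  exact (h this : a ∈ ({a}ᶜ : Set ℕ)) rfl

lemma not_isQPoint_of_le_dyadicFilter {𝒰 : Ultrafilter ℕ}
    (h : (𝒰 : Filter ℕ) ≤ dyadicFilter) : ¬ IsQPoint 𝒰 := by
  rintro ⟨-, hQ⟩
  obtain ⟨A, hA, hsub⟩ := hQ (fun n => Nat.size ⁻¹' {n})
    (fun n => (Set.finite_Iio (2 ^ n)).subset fun x hx =>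
      Nat.size_le.1 (Set.mem_singleton_iff.1 hx).le)
    (fun m n hmn => Disjoint.preimage _ (Set.disjoint_singleton.2 hmn))
    (by ext; simp)
  have hc : Aᶜ ∈ dyadicFilter := by
    refine mem_dyadicFilter.2 ⟨1, fun n => Finset.card_le_one.2 ?_⟩
    have key : ∀ x ∈ dyadicPart Aᶜᶜ n, x ∈ A ∩ Nat.size ⁻¹' {n + 1} := by
      intro x hx
      rw [mem_dyadicPart, compl_compl] at hx
      exact ⟨hx.2, le_antisymm (Nat.size_le.2 hx.1.2) (Nat.lt_size.2 hx.1.1)⟩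
    exact fun x hx y hy => hsub (n + 1) (key x hx) (key y hy)
  exact Ultrafilter.compl_notMem_iff.2 hA (h hc)

/-- Under MA_ctble there is a 𝒲-ultrafilter which is not a Q-point. -/
theorem exists_W_ultrafilter_not_Qpoint (hMA : MActble) :
    ∃ 𝒰 : Ultrafilter ℕ, (∀ a : ℕ, 𝒰 ≠ pure a) ∧
      (∀ f : ℕ → ℕ, ∃ U ∈ 𝒰, ¬ IsAPSet (f '' U)) ∧ ¬ IsQPoint 𝒰 := by
  let e : continuum.{0}.ord.ToType ≃ (ℕ → ℕ) :=
    Classical.choice (Cardinal.eq.1 (by simp))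
  obtain ⟨A, hA, hne⟩ := exists_family_neBot (I := continuum.{0}.ord.ToType) dyadicFilter
    (fun i B => ¬ IsAPSet (e i '' B)) fun i A hi => by
      have heq : ⨅ j, ⨅ h : j < i, 𝓟 (A j h) = ⨅ j : Set.Iio i, 𝓟 (A j.1 j.2) := by
        rw [iInf_subtype]
        rfl
      rw [heq] at hi ⊢
      have hlt : #(Set.Iio i) < continuum := by
        simpa using mk_Iio_lt i (by simp)
      exact exists_not_isAPSet_image hMA hlt _ hi (e i)
  have hle := Ultrafilter.of_le (dyadicFilter ⊓ ⨅ i, 𝓟 (A i))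
  refine ⟨Ultrafilter.of _, ne_pure_of_le_dyadicFilter (hle.trans inf_le_left), fun f => ?_,
    not_isQPoint_of_le_dyadicFilter (hle.trans inf_le_left)⟩
  refine ⟨A (e.symm f), hle (mem_inf_of_right (mem_iInf_of_mem _ (mem_principal_self _))), ?_⟩
  simpa using hA (e.symm f)
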